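/- Let q ≥ 1 be an integer and define K: ℕ × ℕ → ℝ by K(r,t) = (−q)^t · ( q^{−r/2} · I_r^{−2/√q}(t) − (q−1) · Σ_{j=1}^{⌊(t−r)/2⌋} q^{−(r+2j)/2} · I_{r+2j}^{−2/√q}(t) ). Then K(0,0)=1 and K(r,0)=0 for r ≥ 1; K(0,t+1) − K(0,t) = −(q+1)·K(0,t) + (q+1)·K(1,t) for all t ≥ 0; and K(r,t+1) − K(r,t) = −(q+1)·K(r,t) + q·K(r+1,t) + K(r−1,t) for all r ≥ 1 and t ≥ 0. (Thus K is the discrete time heat kernel on the (q+1)-regular tree, as a function of the radial distance r from the base point.) -/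

import Mathlib

open Finset

/-- The discrete `I`-Bessel function `I_n^c(t)` (real parameter `c`). -/
noncomputable def besselI (c : ℝ) (n t : ℕ) : ℝ :=
  if n ≤ t then
    ∑ j ∈ Finset.range ((t - n) / 2 + 1),
      (t.factorial : ℝ) /
          ((j.factorial : ℝ) * ((t - 2 * j - n).factorial : ℝ) * ((n + j).factorial : ℝ)) *
        (c / 2) ^ (2 * j + n)
  else 0

/-- The discrete time heat kernel on the `(q+1)`-regular tree as a function of the radial
distance `r` and time `t`:
`K(r,t) = (-q)^t (q^{-r/2} I_r^{-2/√q}(t) - (q-1) Σ_{j=1}^{⌊(t-r)/2⌋} q^{-(r+2j)/2} I_{r+2j}^{-2/√q}(t))`. -/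
noncomputable def Ktree (q : ℕ) (r t : ℕ) : ℝ :=
  (-(q : ℝ)) ^ t *
    (((Real.sqrt q) ^ r)⁻¹ * besselI (-2 / Real.sqrt q) r t -
      ((q : ℝ) - 1) * ∑ j ∈ Finset.Icc 1 ((t - r) / 2),
        ((Real.sqrt q) ^ (r + 2 * j))⁻¹ * besselI (-2 / Real.sqrt q) (r + 2 * j) t)

theorem besselI_eq_zero_of_lt (c : ℝ) {n t : ℕ} (h : t < n) : besselI c n t = 0 := by
  simp [besselI, not_le.mpr h]

/-- The discrete `I`-Bessel function as a sum of products of binomial coefficients, with any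
sufficiently large number of terms. -/
theorem besselI_eq_sum_choose (c : ℝ) (n : ℕ) {t M : ℕ} (hM : t < M) :
    besselI c n t = ∑ j ∈ range M,
      (t.choose (n + 2 * j) : ℝ) * ((n + 2 * j).choose j : ℝ) * (c / 2) ^ (n + 2 * j) := by
  unfold besselI
  split_ifs with h
  · have hsub : range ((t - n) / 2 + 1) ⊆ range M := range_subset_range.mpr (by omega)
    rw [← sum_subset hsub]
    · refine sum_congr rfl fun j hj ↦ ?_
      rw [mem_range] at hj
      have hle : n + 2 * j ≤ t := by omega
      rw [Nat.cast_choose ℝ hle, Nat.cast_choose ℝ (by omega : j ≤ n + 2 * j),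
        show n + 2 * j - j = n + j by omega, show t - 2 * j - n = t - (n + 2 * j) by omega,
        add_comm (2 * j) n]
      have h1 := Nat.factorial_ne_zero (n + 2 * j)
      field_simp
    · intro j _ hj
      rw [mem_range] at hj
      rw [Nat.choose_eq_zero_of_lt (by omega)]
      simp
  · refine (sum_eq_zero fun j _ ↦ ?_).symm
    rw [Nat.choose_eq_zero_of_lt (by omega)]
    simp

theorem besselI_succ_succ (c : ℝ) (n t : ℕ) :
    besselI c (n + 1) (t + 1) = besselI c (n + 1) t +
      c / 2 * (besselI c n t + besselI c (n + 2) t) := by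
  rw [besselI_eq_sum_choose c (n + 1) (show t + 1 < t + 2 by omega),
    besselI_eq_sum_choose c (n + 1) (show t < t + 2 by omega),
    besselI_eq_sum_choose c n (show t < t + 2 by omega),
    besselI_eq_sum_choose c (n + 2) (show t < t + 1 by omega)]
  simp only [sum_range_succ' _ (t + 1)]
  rw [mul_add, mul_add, mul_sum, mul_sum]
  have key : ∀ j : ℕ,
      ((t + 1).choose (n + 1 + 2 * (j + 1)) : ℝ) * ((n + 1 + 2 * (j + 1)).choose (j + 1) : ℝ) *
          (c / 2) ^ (n + 1 + 2 * (j + 1)) =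
        (t.choose (n + 1 + 2 * (j + 1)) : ℝ) * ((n + 1 + 2 * (j + 1)).choose (j + 1) : ℝ) *
          (c / 2) ^ (n + 1 + 2 * (j + 1)) +
        c / 2 * ((t.choose (n + 2 * (j + 1)) : ℝ) * ((n + 2 * (j + 1)).choose (j + 1) : ℝ) *
          (c / 2) ^ (n + 2 * (j + 1))) +
        c / 2 * ((t.choose (n + 2 + 2 * j) : ℝ) * ((n + 2 + 2 * j).choose j : ℝ) *
          (c / 2) ^ (n + 2 + 2 * j)) := by
    intro j
    rw [show n + 1 + 2 * (j + 1) = (n + 2 + 2 * j) + 1 by ring,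
      show n + 2 * (j + 1) = n + 2 + 2 * j by ring, Nat.choose_succ_succ t,
      Nat.choose_succ_succ _ j]
    push_cast
    ring
  rw [sum_congr rfl fun j _ ↦ key j, sum_add_distrib, sum_add_distrib]
  simp only [mul_zero, add_zero, Nat.choose_zero_right, Nat.choose_succ_succ t n]
  push_cast
  ring

theorem besselI_zero_succ (c : ℝ) (t : ℕ) :
    besselI c 0 (t + 1) = besselI c 0 t + c * besselI c 1 t := by
  rw [besselI_eq_sum_choose c 0 (show t + 1 < t + 2 by omega),
    besselI_eq_sum_choose c 0 (show t < t + 2 by omega),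
    besselI_eq_sum_choose c 1 (show t < t + 1 by omega)]
  simp only [sum_range_succ' _ (t + 1)]
  rw [mul_sum, add_right_comm, ← sum_add_distrib]
  congr 1
  swap
  · simp
  refine sum_congr rfl fun j _ ↦ ?_
  have hc : ((0 + 2 * (j + 1)).choose (j + 1) : ℝ) = 2 * ((1 + 2 * j).choose j : ℝ) := by
    rw [show 0 + 2 * (j + 1) = (2 * j + 1) + 1 by ring, Nat.choose_succ_succ,
      Nat.choose_symm_half, add_comm 1 (2 * j)]
    push_cast
    ring
  rw [hc, show 0 + 2 * (j + 1) = (1 + 2 * j) + 1 by ring, Nat.choose_succ_succ t]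
  push_cast
  ring

/-- The normalized Bessel term `(-q)^t q^{-r/2} I_r^{-2/√q}(t)`. -/
noncomputable def treeTerm (q r t : ℕ) : ℝ :=
  (-(q : ℝ)) ^ t * (((Real.sqrt q) ^ r)⁻¹ * besselI (-2 / Real.sqrt q) r t)

theorem treeTerm_eq_zero_of_lt (q : ℕ) {r t : ℕ} (h : t < r) : treeTerm q r t = 0 := by
  simp [treeTerm, besselI_eq_zero_of_lt _ h]

theorem treeTerm_succ_succ {q : ℕ} (hq : 1 ≤ q) (r t : ℕ) :
    treeTerm q (r + 1) (t + 1) =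
      -q * treeTerm q (r + 1) t + q * treeTerm q (r + 2) t + treeTerm q r t := by
  have hs : Real.sqrt q ≠ 0 := (Real.sqrt_pos.mpr (by exact_mod_cast hq)).ne'
  have hq2 : (q : ℝ) = Real.sqrt q ^ 2 := (Real.sq_sqrt (Nat.cast_nonneg q)).symm
  unfold treeTerm
  rw [besselI_succ_succ]
  generalize Real.sqrt q = s at *
  rw [hq2]
  field_simp
  ring

theorem treeTerm_zero_succ {q : ℕ} (hq : 1 ≤ q) (t : ℕ) :
    treeTerm q 0 (t + 1) = -q * treeTerm q 0 t + 2 * q * treeTerm q 1 t := by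
  have hs : Real.sqrt q ≠ 0 := (Real.sqrt_pos.mpr (by exact_mod_cast hq)).ne'
  have hq2 : (q : ℝ) = Real.sqrt q ^ 2 := (Real.sq_sqrt (Nat.cast_nonneg q)).symm
  unfold treeTerm
  rw [besselI_zero_succ]
  generalize Real.sqrt q = s at *
  rw [hq2]
  field_simp
  ring

theorem Ktree_eq_sum_treeTerm (q r : ℕ) {t M : ℕ} (hM : t ≤ M) :
    Ktree q r t =
      treeTerm q r t - ((q : ℝ) - 1) * ∑ j ∈ range M, treeTerm q (r + 2 * j + 2) t := by
  have hsum : ∑ j ∈ range M, treeTerm q (r + 2 * j + 2) t =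
      ∑ j ∈ Icc 1 ((t - r) / 2), treeTerm q (r + 2 * j) t := by
    rw [← Ico_add_one_right_eq_Icc, sum_Ico_eq_sum_range, Nat.add_sub_cancel]
    have hsub : range ((t - r) / 2) ⊆ range M := range_subset_range.mpr (by omega)
    rw [← sum_subset hsub]
    · exact sum_congr rfl fun j _ ↦ by congr 1; ring
    · intro j _ hj
      rw [mem_range] at hj
      exact treeTerm_eq_zero_of_lt q (by omega)
  rw [hsum]
  simp only [Ktree, treeTerm, ← mul_sum]
  ring

theorem stmt15 (q : ℕ) (hq : 1 ≤ q) :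
    (Ktree q 0 0 = 1 ∧ ∀ r : ℕ, 1 ≤ r → Ktree q r 0 = 0) ∧
    (∀ t : ℕ, Ktree q 0 (t + 1) - Ktree q 0 t =
      -((q : ℝ) + 1) * Ktree q 0 t + ((q : ℝ) + 1) * Ktree q 1 t) ∧
    (∀ r t : ℕ, 1 ≤ r → Ktree q r (t + 1) - Ktree q r t =
      -((q : ℝ) + 1) * Ktree q r t + (q : ℝ) * Ktree q (r + 1) t + Ktree q (r - 1) t) := by
  refine ⟨⟨by simp [Ktree, besselI], fun r hr ↦ ?_⟩, fun t ↦ ?_, fun r t hr ↦ ?_⟩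
  · rw [Ktree_eq_sum_treeTerm q r le_rfl, treeTerm_eq_zero_of_lt q hr]
    simp
  · have hsum : ∑ j ∈ range (t + 1), treeTerm q (0 + 2 * j + 2) (t + 1) =
        -q * ∑ j ∈ range (t + 1), treeTerm q (0 + 2 * j + 2) t +
          q * ∑ j ∈ range (t + 1), treeTerm q (1 + 2 * j + 2) t +
          (treeTerm q 1 t + ∑ j ∈ range t, treeTerm q (1 + 2 * j + 2) t) := by
      have hshift : treeTerm q 1 t + ∑ j ∈ range t, treeTerm q (1 + 2 * j + 2) t =
          ∑ j ∈ range (t + 1), treeTerm q (1 + 2 * j) t := by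
        rw [sum_range_succ', add_comm]
        rfl
      rw [hshift, mul_sum, mul_sum, ← sum_add_distrib, ← sum_add_distrib]
      refine sum_congr rfl fun j _ ↦ ?_
      rw [treeTerm_succ_succ hq, show 0 + 2 * j + 1 = 1 + 2 * j by ring,
        show 1 + 2 * j + 1 = 0 + 2 * j + 2 by ring]
    have hlast : ∑ j ∈ range (t + 1), treeTerm q (1 + 2 * j + 2) t =
        ∑ j ∈ range t, treeTerm q (1 + 2 * j + 2) t := by
      rw [sum_range_succ, treeTerm_eq_zero_of_lt q (by omega), add_zero]
    rw [Ktree_eq_sum_treeTerm q 0 le_rfl, Ktree_eq_sum_treeTerm q 0 t.le_succ,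
      Ktree_eq_sum_treeTerm q 1 le_rfl, hsum, hlast, treeTerm_zero_succ hq]
    ring
  · obtain ⟨r, rfl⟩ := Nat.exists_eq_add_of_le' hr
    have hsum : ∑ j ∈ range (t + 1), treeTerm q (r + 1 + 2 * j + 2) (t + 1) =
        -q * ∑ j ∈ range (t + 1), treeTerm q (r + 1 + 2 * j + 2) t +
          q * ∑ j ∈ range (t + 1), treeTerm q (r + 1 + 1 + 2 * j + 2) t +
          ∑ j ∈ range (t + 1), treeTerm q (r + 2 * j + 2) t := by
      rw [mul_sum, mul_sum, ← sum_add_distrib, ← sum_add_distrib]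
      refine sum_congr rfl fun j _ ↦ ?_
      rw [treeTerm_succ_succ hq, show r + 1 + 2 * j + 1 = r + 2 * j + 2 by ring,
        show r + 2 * j + 2 + 1 = r + 1 + 2 * j + 2 by ring,
        show r + 2 * j + 2 + 2 = r + 1 + 1 + 2 * j + 2 by ring]
    rw [Nat.add_sub_cancel, Ktree_eq_sum_treeTerm q (r + 1) le_rfl,
      Ktree_eq_sum_treeTerm q (r + 1) t.le_succ, Ktree_eq_sum_treeTerm q (r + 1 + 1) t.le_succ,
      Ktree_eq_sum_treeTerm q r t.le_succ, hsum, treeTerm_succ_succ hq]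
    ring
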